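/- Let (A, ≤) be a directed partial order and let (X_α)_{α∈A} be a direct system of sets with transition maps f_{βα} : X_α → X_β for α ≤ β satisfying f_{αα} = id and f_{γβ} ∘ f_{βα} = f_{γα} for α ≤ β ≤ γ. Let N ⊆ A be a subset that is directed under the induced order, and suppose the restricted system over N satisfies the embedding condition: whenever λ, μ ∈ N, α ∈ A with λ ≤ α and μ ≤ α, y ∈ X_λ, x ∈ X_μ, and f_{αλ}(y) = f_{αμ}(x), there exists ν ∈ N with λ ≤ ν, μ ≤ ν and f_{νλ}(y) = f_{νμ}(x). Then the canonical map from the direct limit of the restricted system over N to the direct limit of the full system over A is injective. -/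

import Mathlib

section DirectLimits

variable {A : Type*} [PartialOrder A]
variable (X : A → Type*) (f : ∀ α β : A, α ≤ β → X α → X β)

/-- The relation identifying two elements of the disjoint union `⨿_α X_α` when they are
identified at some common upper bound; the direct limit of the system over `A` is the
quotient by (the equivalence relation generated by) this relation. -/
def relFull : (Σ α : A, X α) → (Σ α : A, X α) → Prop :=
  fun p q => ∃ (γ : A) (h1 : p.1 ≤ γ) (h2 : q.1 ≤ γ), f p.1 γ h1 p.2 = f q.1 γ h2 q.2

/-- The analogous relation for the restricted system over a subset `N ⊆ A`. -/
def relSub (N : Set A) : (Σ ν : N, X ν) → (Σ ν : N, X ν) → Prop :=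
  fun p q => ∃ (γ : N) (h1 : (p.1 : A) ≤ (γ : A)) (h2 : (q.1 : A) ≤ (γ : A)),
    f p.1 γ h1 p.2 = f q.1 γ h2 q.2

/-- The direct limit (as a set) of the full system over `A`. -/
def limitFull : Type _ := Quot (relFull X f)

/-- The direct limit (as a set) of the restricted system over `N ⊆ A`. -/
def limitSub (N : Set A) : Type _ := Quot (relSub X f N)

/-- The canonical map from the direct limit of the restricted system over `N` to the
direct limit of the full system over `A`, induced by the inclusions of the `X_ν`, `ν ∈ N`. -/
def canonicalMap (N : Set A) : limitSub X f N → limitFull X f :=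
  Quot.lift (fun p : Σ ν : N, X ν => Quot.mk (relFull X f) ⟨(p.1 : A), p.2⟩)
    (fun p q h => by
      obtain ⟨γ, h1, h2, e⟩ := h
      exact Quot.sound ⟨(γ : A), h1, h2, e⟩)

/-- Over a directed order, being identified at a common upper bound is an equivalence relation. -/
theorem relFull_equivalence [IsDirected A (· ≤ ·)]
    (hcomp : ∀ (α β γ : A) (h1 : α ≤ β) (h2 : β ≤ γ) (x : X α),
      f β γ h2 (f α β h1 x) = f α γ (h1.trans h2) x) :
    Equivalence (relFull X f) where
  refl p := ⟨p.1, le_rfl, le_rfl, rfl⟩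
  symm := fun ⟨γ, h1, h2, e⟩ => ⟨γ, h2, h1, e.symm⟩
  trans := by
    rintro p q r ⟨γ, h1, h2, e⟩ ⟨δ, h3, h4, e₂⟩
    obtain ⟨ε, hγ, hδ⟩ := exists_ge_ge γ δ
    refine ⟨ε, h1.trans hγ, h4.trans hδ, ?_⟩
    rw [← hcomp _ _ _ h1 hγ, e, hcomp, ← hcomp _ _ _ h4 hδ, ← e₂, hcomp]

/-- **Embedding lemma, after Rubin.** Let `(X_α)_{α ∈ A}` be a direct system
of sets over a directed partial order `A`, and `N ⊆ A` a directed subset satisfying the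
embedding condition.  Then the canonical map from the direct limit of the restricted
system over `N` to the direct limit of the full system over `A` is injective. -/
theorem stmt_7 [IsDirected A (· ≤ ·)] (N : Set A)
    (hrefl : ∀ (α : A) (x : X α), f α α le_rfl x = x)
    (hcomp : ∀ (α β γ : A) (h1 : α ≤ β) (h2 : β ≤ γ) (x : X α),
      f β γ h2 (f α β h1 x) = f α γ (h1.trans h2) x)
    (hNdir : ∀ lam ∈ N, ∀ mu ∈ N, ∃ ν ∈ N, lam ≤ ν ∧ mu ≤ ν)
    (hembed : ∀ lam ∈ N, ∀ mu ∈ N, ∀ (α : A) (h1 : lam ≤ α) (h2 : mu ≤ α)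
      (y : X lam) (x : X mu), f lam α h1 y = f mu α h2 x →
      ∃ ν ∈ N, ∃ (g1 : lam ≤ ν) (g2 : mu ≤ ν), f lam ν g1 y = f mu ν g2 x) :
    Function.Injective (canonicalMap X f N) := by
  rintro ⟨⟨lam, y⟩⟩ ⟨⟨mu, x⟩⟩ h
  obtain ⟨α, h1, h2, e⟩ := (relFull_equivalence X f hcomp).eqvGen_iff.mp (Quot.eqvGen_exact h)
  obtain ⟨ν, hν, g1, g2, e₂⟩ := hembed lam lam.2 mu mu.2 α h1 h2 y x e
  exact Quot.sound ⟨⟨ν, hν⟩, g1, g2, e₂⟩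

end DirectLimits
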